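/- A nonzero element a ∈ ℝ^{2n+1} is a zero divisor of the Vidinli algebra if and only if a·e₁ = 0: for a ≠ 0, there exists b ≠ 0 with a ∗ b = 0 if and only if a ∈ e₁^⊥ (equivalently, the left multiplication map L_a(x) = a ∗ x is singular if and only if a·e₁ = 0). -/

import Mathlib

noncomputable section

/-- Standard dot product on `ℝ^m`. -/
def dot {m : ℕ} (a b : Fin m → ℝ) : ℝ := ∑ i, a i * b i

/-- The distinguished unit vector `e₁` of the Vidinli algebra (index `0`). -/
def e1 (n : ℕ) : Fin (2*n+1) → ℝ := fun i => if i.val = 0 then 1 else 0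

/-- The standard symplectic form `ω` on `ℝ^{2n+1}` (vanishing on `e₁`):
`ω(a,b) = Σ_{k=1}^n (a_{2k} b_{2k+1} − a_{2k+1} b_{2k})` in the paper's 1-based indexing. -/
def omg (n : ℕ) (a b : Fin (2*n+1) → ℝ) : ℝ :=
  ∑ k : Fin n,
    (a ⟨2*k.val+1, by have := k.isLt; omega⟩ * b ⟨2*k.val+2, by have := k.isLt; omega⟩
   - a ⟨2*k.val+2, by have := k.isLt; omega⟩ * b ⟨2*k.val+1, by have := k.isLt; omega⟩)

/-- The Vidinli multiplication on `ℝ^{2n+1}`. -/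
def vprod (n : ℕ) (a b : Fin (2*n+1) → ℝ) : Fin (2*n+1) → ℝ :=
  dot a (e1 n) • b + dot b (e1 n) • a - dot a b • e1 n + omg n a b • e1 n

/-- The standard dot product, as a linear map in its second argument. -/
def dotLinear {m : ℕ} (a : Fin m → ℝ) : (Fin m → ℝ) →ₗ[ℝ] ℝ where
  toFun b := dot a b
  map_add' b c := by simp only [dot, Pi.add_apply, mul_add, Finset.sum_add_distrib]
  map_smul' r b := by
    simp only [dot, Pi.smul_apply, smul_eq_mul, RingHom.id_apply, Finset.mul_sum]
    exact Finset.sum_congr rfl fun i _ => by ring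

/-- The form `omg`, as a linear map in its second argument. -/
def omgLinear (n : ℕ) (a : Fin (2*n+1) → ℝ) : (Fin (2*n+1) → ℝ) →ₗ[ℝ] ℝ where
  toFun b := omg n a b
  map_add' b c := by
    simp only [omg, Pi.add_apply, ← Finset.sum_add_distrib]
    exact Finset.sum_congr rfl fun i _ => by ring
  map_smul' r b := by
    simp only [omg, Pi.smul_apply, smul_eq_mul, RingHom.id_apply, Finset.mul_sum]
    exact Finset.sum_congr rfl fun i _ => by ring

theorem dot_comm {m : ℕ} (a b : Fin m → ℝ) : dot a b = dot b a :=
  Finset.sum_congr rfl fun _ _ => mul_comm _ _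

theorem dot_self_eq_zero {m : ℕ} {a : Fin m → ℝ} : dot a a = 0 ↔ a = 0 :=
  dotProduct_self_eq_zero

theorem dot_e1_e1 (n : ℕ) : dot (e1 n) (e1 n) = 1 := by
  rw [dot, Finset.sum_eq_single 0]
  · simp [e1]
  · intro i _ hi
    have : i.val ≠ 0 := fun h => hi (Fin.ext h)
    simp [e1, this]
  · simp

theorem omg_self (n : ℕ) (a : Fin (2*n+1) → ℝ) : omg n a a = 0 :=
  Finset.sum_eq_zero fun _ _ => by ring

theorem omg_e1 (n : ℕ) (a : Fin (2*n+1) → ℝ) : omg n a (e1 n) = 0 :=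
  Finset.sum_eq_zero fun _ _ => by simp [e1]

/-- Left multiplication by `a` in the Vidinli algebra, as a linear map. -/
def vprodLinear (n : ℕ) (a : Fin (2*n+1) → ℝ) :
    (Fin (2*n+1) → ℝ) →ₗ[ℝ] (Fin (2*n+1) → ℝ) :=
  dot a (e1 n) • LinearMap.id + (dotLinear (e1 n)).smulRight a
    - (dotLinear a).smulRight (e1 n) + (omgLinear n a).smulRight (e1 n)

theorem vprodLinear_apply (n : ℕ) (a b : Fin (2*n+1) → ℝ) :
    vprodLinear n a b = vprod n a b := by
  rw [vprod, dot_comm b]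
  rfl

/-- Applying a linear functional to a Vidinli product. -/
theorem map_vprod (n : ℕ) (f : (Fin (2*n+1) → ℝ) →ₗ[ℝ] ℝ) (a b : Fin (2*n+1) → ℝ) :
    f (vprod n a b) = dot a (e1 n) * f b + dot b (e1 n) * f a
      - dot a b * f (e1 n) + omg n a b * f (e1 n) := by
  simp only [vprod, map_add, map_sub, map_smul, smul_eq_mul]

theorem eq_zero_of_vprod_eq_zero {n : ℕ} {a b : Fin (2*n+1) → ℝ}
    (ha : dot a (e1 n) ≠ 0) (h : vprod n a b = 0) : b = 0 := by
  have ha0 : a ≠ 0 := by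
    rintro rfl
    exact ha (by simp [dot])
  have hω : dot a (e1 n) * omg n a b + dot b (e1 n) * omg n a a
      - dot a b * omg n a (e1 n) + omg n a b * omg n a (e1 n) = 0 := by
    have := map_vprod n (omgLinear n a) a b
    rw [h, map_zero] at this
    exact this.symm
  have hd : dot a (e1 n) * dot a b + dot b (e1 n) * dot a a
      - dot a b * dot a (e1 n) + omg n a b * dot a (e1 n) = 0 := by
    have := map_vprod n (dotLinear a) a b
    rw [h, map_zero] at this
    exact this.symm
  have he : dot a (e1 n) * dot (e1 n) b + dot b (e1 n) * dot (e1 n) a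
      - dot a b * dot (e1 n) (e1 n) + omg n a b * dot (e1 n) (e1 n) = 0 := by
    have := map_vprod n (dotLinear (e1 n)) a b
    rw [h, map_zero] at this
    exact this.symm
  have hω0 : omg n a b = 0 := by simpa [omg_self, omg_e1, ha] using hω
  have hb : dot b (e1 n) = 0 := by
    have : dot b (e1 n) * dot a a = 0 := by
      rw [hω0] at hd
      linarith
    exact (mul_eq_zero.mp this).resolve_right (mt dot_self_eq_zero.mp ha0)
  have hab : dot a b = 0 := by
    rw [dot_comm _ b, hω0, hb, dot_e1_e1] at he
    linarith
  simpa [vprod, hω0, hb, hab, ha] using h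

theorem exists_vprod_eq_zero {n : ℕ} (hn : 1 ≤ n) {a : Fin (2*n+1) → ℝ}
    (ha : dot a (e1 n) = 0) : ∃ b : Fin (2*n+1) → ℝ, b ≠ 0 ∧ vprod n a b = 0 := by
  have hker : LinearMap.ker ((dotLinear (e1 n)).prod (omgLinear n a - dotLinear a)) ≠ ⊥ := by
    apply LinearMap.ker_ne_bot_of_finrank_lt
    simp only [Module.finrank_prod, Module.finrank_self, Module.finrank_fin_fun]
    omega
  obtain ⟨b, hb, hb0⟩ := Submodule.exists_mem_ne_zero_of_ne_bot hker
  obtain ⟨h1, h2⟩ := Prod.mk.inj (LinearMap.mem_ker.mp hb)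
  have h1' : dot b (e1 n) = 0 := (dot_comm _ _).trans h1
  have h2' : omg n a b - dot a b = 0 := h2
  refine ⟨b, hb0, ?_⟩
  rw [vprod, ha, h1', sub_eq_zero.mp h2']
  simp

/-- A nonzero `a` is a zero divisor of the Vidinli algebra iff
`a·e₁ = 0`; equivalently, left multiplication by `a` is singular iff `a·e₁ = 0`. -/
theorem vidinli_zero_divisors (n : ℕ) (hn : 1 ≤ n)
    (a : Fin (2*n+1) → ℝ) (ha : a ≠ 0) :
    ((∃ b : Fin (2*n+1) → ℝ, b ≠ 0 ∧ vprod n a b = 0) ↔ dot a (e1 n) = 0) ∧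
    (¬ Function.Injective (fun x : Fin (2*n+1) → ℝ => vprod n a x) ↔
      dot a (e1 n) = 0) := by
  have key : (∃ b : Fin (2*n+1) → ℝ, b ≠ 0 ∧ vprod n a b = 0) ↔ dot a (e1 n) = 0 := by
    refine ⟨fun ⟨b, hb, h⟩ => ?_, exists_vprod_eq_zero hn⟩
    by_contra h0
    exact hb (eq_zero_of_vprod_eq_zero h0 h)
  refine ⟨key, ?_⟩
  rw [← key]
  simp only [← vprodLinear_apply]
  rw [injective_iff_map_eq_zero (vprodLinear n a)]
  push Not
  exact exists_congr fun _ => and_comm
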